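/- (Proposition 2, abstracted from MHE optimality.) Let T_i > 0, λ ∈ (0,1), let P₁, P₂ ∈ ℝ^{n×n}, Q ∈ ℝ^{q×q}, R ∈ ℝ^{p×p} be symmetric positive definite, and let μ > 0 satisfy |v|²_{P₂} ≤ μ |v|²_{P₁} for all v ∈ ℝⁿ. Let U : ℝⁿ × ℝⁿ → ℝ satisfy |a−b|²_{P₁} ≤ U(a,b) ≤ |a−b|²_{P₂} for all a,b ∈ ℝⁿ. Let x, x̄* : [0,T_i] → ℝⁿ, w, w* : [0,T_i] → ℝ^q, y, y* : [0,T_i] → ℝ^p be functions (with all integrals below finite), let χ* := x̄*(0), and let x̂₀ ∈ ℝⁿ (the prior estimate). Assume: (i) the dissipation inequality U(x(l), x̄*(l)) ≤ U(x(0), χ*) λ^l + ∫₀^l λ^{l−τ}( |w(τ)−w*(τ)|²_Q + |y(τ)−y*(τ)|²_R ) dτ holds for all l ∈ [0,T_i]; and (ii) the optimality inequality 2λ^{T_i} |χ* − x̂₀|²_{P₂} + ∫₀^{T_i} λ^{T_i−τ}( 2|w*(τ)|²_Q + |y(τ)−y*(τ)|²_R ) dτ ≤ 2λ^{T_i} |x(0)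 − x̂₀|²_{P₂} + 2∫₀^{T_i} λ^{T_i−τ} |w(τ)|²_Q dτ. Then for all l ∈ [0,T_i]: U(x(l), x̄*(l)) ≤ λ^{−(T_i − l)} ( 4μ λ^{T_i} U(x(0), x̂₀) + 4∫₀^{T_i} λ^{T_i−τ} |w(τ)|²_Q dτ ). -/

import Mathlib

open MeasureTheory Matrix Set

/-- Quadratic norm `|v|²_M = vᵀ M v` associated with a matrix `M`. -/
noncomputable def qN {k : ℕ} (M : Matrix (Fin k) (Fin k) ℝ) (v : Fin k → ℝ) : ℝ :=
  v ⬝ᵥ (M *ᵥ v)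

theorem qN_nonneg {k : ℕ} {M : Matrix (Fin k) (Fin k) ℝ} (hM : M.PosDef) (v : Fin k → ℝ) :
    0 ≤ qN M v := by
  simpa [qN] using hM.posSemidef.dotProduct_mulVec_nonneg v

theorem qN_add_add_qN_sub {k : ℕ} (M : Matrix (Fin k) (Fin k) ℝ) (a b : Fin k → ℝ) :
    qN M (a + b) + qN M (a - b) = 2 * qN M a + 2 * qN M b := by
  simp only [qN, mulVec_add, mulVec_sub, dotProduct_add, dotProduct_sub, add_dotProduct,
    sub_dotProduct]
  ring

theorem qN_sub_le {k : ℕ} {M : Matrix (Fin k) (Fin k) ℝ} (hM : M.PosDef) (a b : Fin k → ℝ) :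
    qN M (a - b) ≤ 2 * qN M a + 2 * qN M b := by
  linarith [qN_add_add_qN_sub M a b, qN_nonneg hM (a + b)]

/-- Proposition 2, abstracted from MHE optimality:
the i-iIOSS dissipation inequality along the optimal MHE trajectory together with
the optimality inequality yields the per-window contraction bound
`U(x(l), x̄*(l)) ≤ λ^{−(T_i−l)} (4μ λ^{T_i} U(x(0), x̂₀) + 4∫₀^{T_i} λ^{T_i−τ}|w(τ)|²_Q dτ)`. -/
theorem mhe_per_window_bound {n q p : ℕ}
    (Ti lam : ℝ) (hTi : 0 < Ti) (hlam : lam ∈ Set.Ioo (0:ℝ) 1)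
    (P₁ P₂ : Matrix (Fin n) (Fin n) ℝ) (Q : Matrix (Fin q) (Fin q) ℝ)
    (R : Matrix (Fin p) (Fin p) ℝ)
    (hP₁ : P₁.PosDef) (hP₂ : P₂.PosDef) (hQ : Q.PosDef) (hR : R.PosDef)
    (μ : ℝ) (hμ : 0 < μ) (hμP : ∀ v : Fin n → ℝ, qN P₂ v ≤ μ * qN P₁ v)
    (U : (Fin n → ℝ) → (Fin n → ℝ) → ℝ)
    (hU : ∀ a b : Fin n → ℝ, qN P₁ (a - b) ≤ U a b ∧ U a b ≤ qN P₂ (a - b))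
    (x xbs : ℝ → Fin n → ℝ) (w ws : ℝ → Fin q → ℝ) (y ys : ℝ → Fin p → ℝ)
    (xhat₀ : Fin n → ℝ)
    -- all integrals below are finite:
    (hint1 : ∀ l ∈ Set.Icc (0:ℝ) Ti, IntervalIntegrable
      (fun τ => lam ^ (l - τ) * (qN Q (w τ - ws τ) + qN R (y τ - ys τ))) volume 0 l)
    (hint2 : IntervalIntegrable (fun τ => lam ^ (Ti - τ) * qN Q (w τ - ws τ)) volume 0 Ti)
    (hint3 : IntervalIntegrable (fun τ => lam ^ (Ti - τ) * qN R (y τ - ys τ)) volume 0 Ti)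
    (hint4 : IntervalIntegrable (fun τ => lam ^ (Ti - τ) * qN Q (ws τ)) volume 0 Ti)
    (hint5 : IntervalIntegrable (fun τ => lam ^ (Ti - τ) * qN Q (w τ)) volume 0 Ti)
    -- (i) dissipation inequality:
    (hdiss : ∀ l ∈ Set.Icc (0:ℝ) Ti,
      U (x l) (xbs l) ≤ U (x 0) (xbs 0) * lam ^ l +
        ∫ τ in (0:ℝ)..l, lam ^ (l - τ) * (qN Q (w τ - ws τ) + qN R (y τ - ys τ)))
    -- (ii) optimality inequality:
    (hopt : 2 * lam ^ Ti * qN P₂ (xbs 0 - xhat₀) +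
        (∫ τ in (0:ℝ)..Ti, lam ^ (Ti - τ) * (2 * qN Q (ws τ) + qN R (y τ - ys τ)))
      ≤ 2 * lam ^ Ti * qN P₂ (x 0 - xhat₀) +
        2 * ∫ τ in (0:ℝ)..Ti, lam ^ (Ti - τ) * qN Q (w τ)) :
    ∀ l ∈ Set.Icc (0:ℝ) Ti,
      U (x l) (xbs l) ≤ lam ^ (-(Ti - l)) *
        (4 * μ * lam ^ Ti * U (x 0) xhat₀ +
          4 * ∫ τ in (0:ℝ)..Ti, lam ^ (Ti - τ) * qN Q (w τ)) := by
  intro l hl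
  have hlam0 : 0 < lam := hlam.1
  have hpow (t : ℝ) : 0 < lam ^ t := Real.rpow_pos_of_pos hlam0 t
  have hshift (s t : ℝ) : lam ^ (Ti - l) * (lam ^ (l - s) * t) = lam ^ (Ti - s) * t := by
    rw [← mul_assoc, ← Real.rpow_add hlam0]
    ring_nf
  have hU₀ : U (x 0) (xbs 0) ≤ 2 * qN P₂ (x 0 - xhat₀) + 2 * qN P₂ (xbs 0 - xhat₀) := by
    have h := qN_sub_le hP₂ (x 0 - xhat₀) (xbs 0 - xhat₀)
    rw [sub_sub_sub_cancel_right] at h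
    exact (hU _ _).2.trans h
  have hprior : qN P₂ (x 0 - xhat₀) ≤ μ * U (x 0) xhat₀ :=
    (hμP _).trans (mul_le_mul_of_nonneg_left (hU _ _).1 hμ.le)
  have hstage : lam ^ (Ti - l) *
        (∫ τ in (0:ℝ)..l, lam ^ (l - τ) * (qN Q (w τ - ws τ) + qN R (y τ - ys τ)))
      ≤ ∫ τ in (0:ℝ)..Ti, lam ^ (Ti - τ) * (qN Q (w τ - ws τ) + qN R (y τ - ys τ)) := by
    rw [← intervalIntegral.integral_const_mul]
    simp only [hshift]
    refine intervalIntegral.integral_mono_interval le_rfl hl.1 hl.2 ?_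
      (hint1 Ti ⟨hTi.le, le_rfl⟩)
    exact Filter.Eventually.of_forall fun τ =>
      mul_nonneg (hpow _).le (add_nonneg (qN_nonneg hQ _) (qN_nonneg hR _))
  have hopt_int : IntervalIntegrable
      (fun τ => lam ^ (Ti - τ) * (2 * qN Q (ws τ) + qN R (y τ - ys τ))) volume 0 Ti := by
    convert (hint4.const_mul 2).add hint3 using 1
    funext τ
    ring
  have hsplit : (∫ τ in (0:ℝ)..Ti,
        lam ^ (Ti - τ) * (qN Q (w τ - ws τ) + qN R (y τ - ys τ)))
      ≤ 2 * (∫ τ in (0:ℝ)..Ti, lam ^ (Ti - τ) * qN Q (w τ)) +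
        ∫ τ in (0:ℝ)..Ti, lam ^ (Ti - τ) * (2 * qN Q (ws τ) + qN R (y τ - ys τ)) := by
    rw [← intervalIntegral.integral_const_mul,
      ← intervalIntegral.integral_add (hint5.const_mul 2) hopt_int]
    refine intervalIntegral.integral_mono_on hTi.le (hint1 Ti ⟨hTi.le, le_rfl⟩)
      ((hint5.const_mul 2).add hopt_int) fun τ _ => ?_
    have h := mul_le_mul_of_nonneg_left (qN_sub_le hQ (w τ) (ws τ)) (hpow (Ti - τ)).le
    linarith
  have hd := mul_le_mul_of_nonneg_left (hdiss l hl) (hpow (Ti - l)).le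
  have hinit : lam ^ (Ti - l) * (U (x 0) (xbs 0) * lam ^ l) = lam ^ Ti * U (x 0) (xbs 0) := by
    simpa [mul_comm] using hshift 0 (U (x 0) (xbs 0))
  rw [mul_add, hinit] at hd
  have h₁ := mul_le_mul_of_nonneg_left hU₀ (hpow Ti).le
  have h₂ := mul_le_mul_of_nonneg_left hprior (hpow Ti).le
  rw [Real.rpow_neg hlam0.le, inv_mul_eq_div, le_div_iff₀ (hpow _)]
  linarith
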